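/- Let N ≥ 10 be an integer and 0 < A < B ≤ 1. Then the function ω[A,B] : (0,1] → ℝ is strictly positive on (0,1], is C¹ on (0,1], satisfies ω[A,B](1) = 1, satisfies ∫₀¹ r^{N−1}(ω[A,B](r)² + ω[A,B]'(r)²) dr < ∞, and satisfies pointwise w''(r) + ((N−1)/r)·w'(r) + (Ψ_{A,B}(r) − (N−1)/r²)·w(r) = 0 for every r ∈ (0,1) with r ≠ A and r ≠ B. -/

import Mathlib

open MeasureTheory Filter Set

/-- The denominator `D = (N-2)²B^(N-4) - 4A^(N-4) + 2(N-2)Bᴺ(B^(N-4) - A^(N-4))`. -/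
noncomputable def DAB (N : ℕ) (A B : ℝ) : ℝ :=
  ((N:ℝ) - 2) ^ 2 * B ^ (N - 4) - 4 * A ^ (N - 4)
    + 2 * ((N:ℝ) - 2) * B ^ N * (B ^ (N - 4) - A ^ (N - 4))

/-- The explicit radial function `ω[A,B]` of Lemma 2.2. -/
noncomputable def omegaAB (N : ℕ) (A B : ℝ) (r : ℝ) : ℝ :=
  if r < A then
    (N : ℝ) * ((N:ℝ) - 4) * B ^ (N - 2) * A ^ (-2 : ℤ) * r / DAB N A B
  else if r ≤ B then
    ((N : ℝ) * ((N:ℝ) - 2) * B ^ (N - 2) * r ^ (-1 : ℤ)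
      - 2 * (N : ℝ) * A ^ (N - 4) * B ^ (N - 2) * r ^ ((3:ℤ) - (N:ℤ))) / DAB N A B
  else
    ((((N:ℝ) - 2) ^ 2 * B ^ (N - 4) - 4 * A ^ (N - 4)) * r
      + 2 * ((N:ℝ) - 2) * B ^ N * (B ^ (N - 4) - A ^ (N - 4)) * r ^ ((1:ℤ) - (N:ℤ)))
      / DAB N A B

/-- The potential `Ψ_{A,B}`: equal to `2(N-2)/r²` on `[A,B]` and `0` elsewhere. -/
noncomputable def PsiAB (N : ℕ) (A B : ℝ) (r : ℝ) : ℝ :=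
  if A ≤ r ∧ r ≤ B then 2 * ((N:ℝ) - 2) / r ^ 2 else 0

open Topology

/-- Gluing at `a` two continuous functions that agree there. -/
lemma continuousAt_ite_le {f g : ℝ → ℝ} {a r : ℝ} (hf : r ≤ a → ContinuousAt f r)
    (hg : a ≤ r → ContinuousAt g r) (h : f a = g a) :
    ContinuousAt (fun x => if x ≤ a then f x else g x) r := by
  rcases lt_trichotomy r a with hr | rfl | hr
  · refine (hf hr.le).congr ?_
    filter_upwards [Iio_mem_nhds hr] with x hx
    exact (if_pos (le_of_lt hx)).symm
  · rw [← continuousWithinAt_univ, ← Iic_union_Ici (a := r)]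
    refine ContinuousWithinAt.union ?_ ?_
    · refine (hf le_rfl).continuousWithinAt.congr (fun x hx => if_pos hx) (if_pos le_rfl)
    · refine (hg le_rfl).continuousWithinAt.congr (fun x hx => ?_) (by simp [h])
      rcases eq_or_lt_of_le (show r ≤ x from hx) with rfl | hx
      · simp [h]
      · exact if_neg (not_le.2 hx)
  · refine (hg hr.le).congr ?_
    filter_upwards [Ioi_mem_nhds hr] with x hx
    exact (if_neg (not_le.2 hx)).symm

/-- Gluing at `a` two differentiable functions that agree there to first order. -/
lemma hasDerivAt_ite_le {f g f' g' : ℝ → ℝ} {a r : ℝ} (hf : r ≤ a → HasDerivAt f (f' r) r)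
    (hg : a ≤ r → HasDerivAt g (g' r) r) (h : f a = g a) (h' : f' a = g' a) :
    HasDerivAt (fun x => if x ≤ a then f x else g x) (if r ≤ a then f' r else g' r) r := by
  rcases lt_trichotomy r a with hr | rfl | hr
  · rw [if_pos hr.le]
    refine (hf hr.le).congr_of_eventuallyEq ?_
    filter_upwards [Iio_mem_nhds hr] with x hx
    exact if_pos (le_of_lt hx)
  · rw [if_pos le_rfl, ← hasDerivWithinAt_univ, ← Iic_union_Ici (a := r)]
    refine HasDerivWithinAt.union ?_ ?_
    · refine (hf le_rfl).hasDerivWithinAt.congr (fun x hx => if_pos hx) (if_pos le_rfl)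
    · rw [h']
      refine (hg le_rfl).hasDerivWithinAt.congr (fun x hx => ?_) (by simp [h])
      rcases eq_or_lt_of_le (show r ≤ x from hx) with rfl | hx
      · simp [h]
      · exact if_neg (not_le.2 hx)
  · rw [if_neg (not_le.2 hr)]
    refine (hg hr.le).congr_of_eventuallyEq ?_
    filter_upwards [Ioi_mem_nhds hr] with x hx
    exact if_neg (not_le.2 hx)

lemma hasDerivAt_zpow_add_zpow (c d : ℝ) (k m : ℤ) {r : ℝ} (hr : r ≠ 0) :
    HasDerivAt (fun x => c * x ^ k + d * x ^ m)
      (c * k * r ^ (k - 1) + d * m * r ^ (m - 1)) r := by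
  rw [mul_assoc c, mul_assoc d]
  exact ((hasDerivAt_zpow k r (.inl hr)).const_mul c).add
    ((hasDerivAt_zpow m r (.inl hr)).const_mul d)

/-- Powers whose exponents solve the indicial equation solve the Euler equation. -/
lemma euler_ode_of_eventuallyEq {w : ℝ → ℝ} {c d p s r : ℝ} {k m : ℤ} (hr : r ≠ 0)
    (hw : w =ᶠ[𝓝 r] fun x => c * x ^ k + d * x ^ m)
    (hk : (k : ℝ) * (k - 1) + p * k + (s - p) = 0)
    (hm : (m : ℝ) * (m - 1) + p * m + (s - p) = 0) :
    deriv (deriv w) r + p / r * deriv w r + (s / r ^ 2 - p / r ^ 2) * w r = 0 := by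
  have hd : deriv (fun x => c * x ^ k + d * x ^ m) =ᶠ[𝓝 r]
      fun x => c * k * x ^ (k - 1) + d * m * x ^ (m - 1) := by
    filter_upwards [isOpen_ne.mem_nhds hr] with x hx
    exact (hasDerivAt_zpow_add_zpow c d k m hx).deriv
  rw [(hw.deriv.trans hd).deriv_eq, (hasDerivAt_zpow_add_zpow _ _ _ _ hr).deriv,
    (hw.deriv.trans hd).eq_of_nhds, hw.eq_of_nhds]
  simp only [zpow_sub_one₀ hr]
  push_cast
  field_simp
  linear_combination c * r ^ k * hk + d * r ^ m * hm

/-- The derivative of `ω[A,B]`. -/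
noncomputable def omegaABDeriv (N : ℕ) (A B : ℝ) (r : ℝ) : ℝ :=
  if r ≤ A then
    (N : ℝ) * ((N:ℝ) - 4) * B ^ (N - 2) * A ^ (-2 : ℤ) / DAB N A B
  else if r ≤ B then
    (N : ℝ) * ((N:ℝ) - 2) * B ^ (N - 2) / DAB N A B * ((-1 : ℤ) : ℝ) * r ^ ((-1 : ℤ) - 1)
      + -(2 * (N : ℝ) * A ^ (N - 4) * B ^ (N - 2)) / DAB N A B * ((3 - N : ℤ) : ℝ)
        * r ^ ((3:ℤ) - (N:ℤ) - 1)
  else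
    (((N:ℝ) - 2) ^ 2 * B ^ (N - 4) - 4 * A ^ (N - 4)) / DAB N A B * ((1 : ℤ) : ℝ)
        * r ^ ((1 : ℤ) - 1)
      + 2 * ((N:ℝ) - 2) * B ^ N * (B ^ (N - 4) - A ^ (N - 4)) / DAB N A B
        * ((1 - N : ℤ) : ℝ) * r ^ ((1:ℤ) - (N:ℤ) - 1)

lemma outer_matching (n : ℕ) {A B : ℝ} (D : ℝ) (hB : 0 < B) :
    ((n + 4 : ℕ) : ℝ) * (((n + 4 : ℕ) : ℝ) - 2) * B ^ (n + 4 - 2) / D * B ^ (-1 : ℤ)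
      + -(2 * ((n + 4 : ℕ) : ℝ) * A ^ (n + 4 - 4) * B ^ (n + 4 - 2)) / D
        * B ^ ((3:ℤ) - ((n + 4 : ℕ) : ℤ))
    = ((((n + 4 : ℕ) : ℝ) - 2) ^ 2 * B ^ (n + 4 - 4) - 4 * A ^ (n + 4 - 4)) / D * B ^ (1 : ℤ)
      + 2 * (((n + 4 : ℕ) : ℝ) - 2) * B ^ (n + 4) * (B ^ (n + 4 - 4) - A ^ (n + 4 - 4)) / D
        * B ^ ((1:ℤ) - ((n + 4 : ℕ) : ℤ)) := by
  have e : (3 : ℤ) - ((n + 4 : ℕ) : ℤ) = -((n + 1 : ℕ) : ℤ) := by push_cast; ring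
  have e' : (1 : ℤ) - ((n + 4 : ℕ) : ℤ) = -((n + 3 : ℕ) : ℤ) := by push_cast; ring
  rw [e, e', zpow_neg, zpow_neg, zpow_neg, zpow_natCast, zpow_natCast, zpow_one,
    show n + 4 - 2 = n + 2 by omega, Nat.add_sub_cancel]
  push_cast
  simp only [pow_add]
  field_simp
  ring

lemma outer_deriv_matching (n : ℕ) {A B : ℝ} (D : ℝ) (hB : 0 < B) :
    ((n + 4 : ℕ) : ℝ) * (((n + 4 : ℕ) : ℝ) - 2) * B ^ (n + 4 - 2) / D * ((-1 : ℤ) : ℝ)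
        * B ^ ((-1 : ℤ) - 1)
      + -(2 * ((n + 4 : ℕ) : ℝ) * A ^ (n + 4 - 4) * B ^ (n + 4 - 2)) / D
        * ((3 - (n + 4 : ℕ) : ℤ) : ℝ) * B ^ ((3:ℤ) - ((n + 4 : ℕ) : ℤ) - 1)
    = ((((n + 4 : ℕ) : ℝ) - 2) ^ 2 * B ^ (n + 4 - 4) - 4 * A ^ (n + 4 - 4)) / D
        * ((1 : ℤ) : ℝ) * B ^ ((1 : ℤ) - 1)
      + 2 * (((n + 4 : ℕ) : ℝ) - 2) * B ^ (n + 4) * (B ^ (n + 4 - 4) - A ^ (n + 4 - 4)) / D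
        * ((1 - (n + 4 : ℕ) : ℤ) : ℝ) * B ^ ((1:ℤ) - ((n + 4 : ℕ) : ℤ) - 1) := by
  have e : (3 : ℤ) - ((n + 4 : ℕ) : ℤ) - 1 = -((n + 2 : ℕ) : ℤ) := by push_cast; ring
  have e' : (1 : ℤ) - ((n + 4 : ℕ) : ℤ) - 1 = -((n + 4 : ℕ) : ℤ) := by push_cast; ring
  have e'' : (-1 : ℤ) - 1 = -((2 : ℕ) : ℤ) := by norm_num
  rw [e, e', e'', zpow_neg, zpow_neg, zpow_neg, zpow_natCast, zpow_natCast, zpow_natCast, sub_self,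
    zpow_zero, show n + 4 - 2 = n + 2 by omega, Nat.add_sub_cancel]
  push_cast
  simp only [pow_add]
  field_simp
  ring

lemma inner_matching (n : ℕ) {A B : ℝ} (D : ℝ) (hA : 0 < A) :
    ((n + 4 : ℕ) : ℝ) * (((n + 4 : ℕ) : ℝ) - 4) * B ^ (n + 4 - 2) * A ^ (-2 : ℤ) / D * A
    = ((n + 4 : ℕ) : ℝ) * (((n + 4 : ℕ) : ℝ) - 2) * B ^ (n + 4 - 2) / D * A ^ (-1 : ℤ)
      + -(2 * ((n + 4 : ℕ) : ℝ) * A ^ (n + 4 - 4) * B ^ (n + 4 - 2)) / D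
        * A ^ ((3:ℤ) - ((n + 4 : ℕ) : ℤ)) := by
  have e : (3 : ℤ) - ((n + 4 : ℕ) : ℤ) = -((n + 1 : ℕ) : ℤ) := by push_cast; ring
  have e'' : (-2 : ℤ) = -((2 : ℕ) : ℤ) := by norm_num
  rw [e, e'', zpow_neg, zpow_neg, zpow_neg, zpow_natCast, zpow_natCast, zpow_one,
    Nat.add_sub_cancel]
  push_cast
  rw [pow_succ A n]
  field_simp
  ring

lemma inner_deriv_matching (n : ℕ) {A B : ℝ} (D : ℝ) (hA : 0 < A) :
    ((n + 4 : ℕ) : ℝ) * (((n + 4 : ℕ) : ℝ) - 4) * B ^ (n + 4 - 2) * A ^ (-2 : ℤ) / D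
    = ((n + 4 : ℕ) : ℝ) * (((n + 4 : ℕ) : ℝ) - 2) * B ^ (n + 4 - 2) / D * ((-1 : ℤ) : ℝ)
        * A ^ ((-1 : ℤ) - 1)
      + -(2 * ((n + 4 : ℕ) : ℝ) * A ^ (n + 4 - 4) * B ^ (n + 4 - 2)) / D
        * ((3 - (n + 4 : ℕ) : ℤ) : ℝ) * A ^ ((3:ℤ) - ((n + 4 : ℕ) : ℤ) - 1) := by
  have e : (3 : ℤ) - ((n + 4 : ℕ) : ℤ) - 1 = -((n + 2 : ℕ) : ℤ) := by push_cast; ring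
  have e' : (-1 : ℤ) - 1 = -((2 : ℕ) : ℤ) := by norm_num
  have e'' : (-2 : ℤ) = -((2 : ℕ) : ℤ) := by norm_num
  rw [e, e', e'', zpow_neg, zpow_neg, zpow_natCast, zpow_natCast, Nat.add_sub_cancel]
  push_cast
  rw [pow_add A n]
  field_simp
  ring

/-- `ω[A,B]` as a gluing of sums of two powers. -/
lemma omegaAB_eq (N : ℕ) (hN : 4 ≤ N) {A B : ℝ} (hA : 0 < A) (hAB : A < B) :
    omegaAB N A B = fun r => if r ≤ A then
      (N : ℝ) * ((N:ℝ) - 4) * B ^ (N - 2) * A ^ (-2 : ℤ) / DAB N A B * r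
    else if r ≤ B then
      (N : ℝ) * ((N:ℝ) - 2) * B ^ (N - 2) / DAB N A B * r ^ (-1 : ℤ)
        + -(2 * (N : ℝ) * A ^ (N - 4) * B ^ (N - 2)) / DAB N A B * r ^ ((3:ℤ) - (N:ℤ))
    else
      (((N:ℝ) - 2) ^ 2 * B ^ (N - 4) - 4 * A ^ (N - 4)) / DAB N A B * r ^ (1 : ℤ)
        + 2 * ((N:ℝ) - 2) * B ^ N * (B ^ (N - 4) - A ^ (N - 4)) / DAB N A B
          * r ^ ((1:ℤ) - (N:ℤ)) := by
  obtain ⟨n, rfl⟩ := Nat.exists_eq_add_of_le' hN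
  funext r
  unfold omegaAB
  rcases lt_trichotomy r A with h | h | h
  · rw [if_pos h, if_pos h.le]; ring
  · rw [h, if_neg (lt_irrefl _), if_pos hAB.le, if_pos le_rfl, inner_matching n _ hA]; ring
  · rw [if_neg h.le.not_gt, if_neg h.not_ge]
    split_ifs
    · ring
    · rw [zpow_one]; ring

lemma hasDerivAt_omegaAB (N : ℕ) (hN : 4 ≤ N) {A B : ℝ} (hA : 0 < A) (hAB : A < B) (r : ℝ) :
    HasDerivAt (omegaAB N A B) (omegaABDeriv N A B r) r := by
  rw [omegaAB_eq N hN hA hAB]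
  obtain ⟨n, rfl⟩ := Nat.exists_eq_add_of_le' hN
  unfold omegaABDeriv
  apply hasDerivAt_ite_le
  · exact fun _ => hasDerivAt_const_mul _
  · intro hr
    have hr0 : r ≠ 0 := (hA.trans_le hr).ne'
    apply hasDerivAt_ite_le
    · exact fun _ => hasDerivAt_zpow_add_zpow _ _ _ _ hr0
    · exact fun _ => hasDerivAt_zpow_add_zpow _ _ _ _ hr0
    · exact outer_matching n _ (hA.trans hAB)
    · exact outer_deriv_matching n _ (hA.trans hAB)
  · rw [if_pos hAB.le]
    exact inner_matching n _ hA
  · rw [if_pos hAB.le]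
    exact inner_deriv_matching n _ hA

lemma continuous_omegaABDeriv (N : ℕ) (hN : 4 ≤ N) {A B : ℝ} (hA : 0 < A) (hAB : A < B) :
    Continuous (omegaABDeriv N A B) := by
  obtain ⟨n, rfl⟩ := Nat.exists_eq_add_of_le' hN
  rw [continuous_iff_continuousAt]
  intro r
  refine continuousAt_ite_le (fun _ => continuousAt_const) (fun hr => ?_) ?_
  · have hr0 : r ≠ 0 := (hA.trans_le hr).ne'
    exact continuousAt_ite_le (fun _ => (hasDerivAt_zpow_add_zpow _ _ _ _ hr0).continuousAt)
      (fun _ => (hasDerivAt_zpow_add_zpow _ _ _ _ hr0).continuousAt)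
      (outer_deriv_matching n _ (hA.trans hAB))
  · rw [if_pos hAB.le]
    exact inner_deriv_matching n _ hA

lemma contDiff_omegaAB (N : ℕ) (hN : 4 ≤ N) {A B : ℝ} (hA : 0 < A) (hAB : A < B) :
    ContDiff ℝ 1 (omegaAB N A B) := by
  rw [contDiff_one_iff_deriv]
  refine ⟨fun r => (hasDerivAt_omegaAB N hN hA hAB r).differentiableAt, ?_⟩
  rw [funext fun r => (hasDerivAt_omegaAB N hN hA hAB r).deriv]
  exact continuous_omegaABDeriv N hN hA hAB

lemma outer_coeff_pos (N : ℕ) (hN : 5 ≤ N) {A B : ℝ} (hA : 0 < A) (hAB : A < B) :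
    0 < ((N:ℝ) - 2) ^ 2 * B ^ (N - 4) - 4 * A ^ (N - 4) := by
  have hN' : (5 : ℝ) ≤ N := by exact_mod_cast hN
  have hlt : A ^ (N - 4) < B ^ (N - 4) := pow_lt_pow_left₀ hAB hA.le (by omega)
  have hA' : 0 < A ^ (N - 4) := pow_pos hA _
  nlinarith [mul_pos (show (0 : ℝ) < ((N : ℝ) - 2) ^ 2 - 4 by nlinarith) (hA'.trans hlt)]

lemma outer_coeff_pos' (N : ℕ) (hN : 5 ≤ N) {A B : ℝ} (hA : 0 < A) (hAB : A < B) :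
    0 < 2 * ((N:ℝ) - 2) * B ^ N * (B ^ (N - 4) - A ^ (N - 4)) := by
  have hN' : (0 : ℝ) < (N : ℝ) - 2 := by
    have : (5 : ℝ) ≤ N := by exact_mod_cast hN
    linarith
  have hlt : 0 < B ^ (N - 4) - A ^ (N - 4) :=
    sub_pos.2 (pow_lt_pow_left₀ hAB hA.le (by omega))
  have hB := hA.trans hAB
  positivity

lemma DAB_pos (N : ℕ) (hN : 5 ≤ N) {A B : ℝ} (hA : 0 < A) (hAB : A < B) : 0 < DAB N A B :=
  add_pos (outer_coeff_pos N hN hA hAB) (outer_coeff_pos' N hN hA hAB)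

lemma omegaAB_pos (N : ℕ) (hN : 5 ≤ N) {A B r : ℝ} (hA : 0 < A) (hAB : A < B) (hr : 0 < r) :
    0 < omegaAB N A B r := by
  have hD := DAB_pos N hN hA hAB
  have h₁ := outer_coeff_pos N hN hA hAB
  have h₂ := outer_coeff_pos' N hN hA hAB
  have hB := hA.trans hAB
  have hN' : (5 : ℝ) ≤ N := by exact_mod_cast hN
  unfold omegaAB
  split_ifs with hrA hrB
  · have : (0 : ℝ) < (N : ℝ) - 4 := by linarith
    positivity
  · refine div_pos ?_ hD
    obtain ⟨n, rfl⟩ := Nat.exists_eq_add_of_le' (show 4 ≤ N by omega)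
    have e : (3 : ℤ) - ((n + 4 : ℕ) : ℤ) = -(n : ℤ) + -1 := by push_cast; ring
    rw [e, zpow_add₀ hr.ne', zpow_neg r n, zpow_natCast, Nat.add_sub_cancel]
    have hle : A ^ n * (r ^ n)⁻¹ ≤ 1 := by
      rw [← div_eq_mul_inv]
      exact div_le_one_of_le₀ (pow_le_pow_left₀ hA.le (not_lt.1 hrA) n) (by positivity)
    have hpos : 0 < ((n + 4 : ℕ) : ℝ) - 2 - 2 * (A ^ n * (r ^ n)⁻¹) := by linarith
    have : 0 < ((n + 4 : ℕ) : ℝ) * B ^ (n + 4 - 2) * r ^ (-1 : ℤ)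
        * (((n + 4 : ℕ) : ℝ) - 2 - 2 * (A ^ n * (r ^ n)⁻¹)) := by positivity
    linarith
  · positivity

lemma omegaAB_one (N : ℕ) (hN : 5 ≤ N) {A B : ℝ} (hA : 0 < A) (hAB : A < B) (hB : B ≤ 1) :
    omegaAB N A B 1 = 1 := by
  have hD := (DAB_pos N hN hA hAB).ne'
  unfold omegaAB
  rw [if_neg (by linarith)]
  split_ifs with h
  · obtain rfl : B = 1 := le_antisymm hB h
    rw [div_eq_one_iff_eq hD]
    simp only [DAB, one_zpow, one_pow]
    ring
  · rw [div_eq_one_iff_eq hD]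
    simp only [DAB, one_zpow]
    ring

lemma omegaAB_ode (N : ℕ) (hN : 4 ≤ N) {A B r : ℝ} (hA : 0 < A) (hAB : A < B) (hr : 0 < r)
    (hrA : r ≠ A) (hrB : r ≠ B) :
    deriv (deriv (omegaAB N A B)) r + ((N:ℝ) - 1) / r * deriv (omegaAB N A B) r
        + (PsiAB N A B r - ((N:ℝ) - 1) / r ^ 2) * omegaAB N A B r = 0 := by
  rw [omegaAB_eq N hN hA hAB]
  rcases lt_or_gt_of_ne hrA with h | h
  · have hPsi : PsiAB N A B r = 0 / r ^ 2 := by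
      rw [PsiAB, if_neg (fun h' => h.not_ge h'.1), zero_div]
    rw [hPsi]
    refine euler_ode_of_eventuallyEq (k := 1) (m := 1) (d := 0)
      (c := (N : ℝ) * ((N:ℝ) - 4) * B ^ (N - 2) * A ^ (-2 : ℤ) / DAB N A B) hr.ne' ?_
      (by push_cast; ring) (by push_cast; ring)
    filter_upwards [Iio_mem_nhds h] with x hx
    rw [if_pos (le_of_lt hx), zpow_one, zero_mul, add_zero]
  · rcases lt_or_gt_of_ne hrB with h' | h'
    · rw [PsiAB, if_pos ⟨h.le, h'.le⟩]
      exact euler_ode_of_eventuallyEq hr.ne' (eventuallyEq_of_mem (Ioo_mem_nhds h h') fun x hx =>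
        (if_neg (not_le.2 hx.1)).trans (if_pos hx.2.le)) (by push_cast; ring) (by push_cast; ring)
    · have hPsi : PsiAB N A B r = 0 / r ^ 2 := by
        rw [PsiAB, if_neg (fun h'' => h'.not_ge h''.2), zero_div]
      rw [hPsi]
      exact euler_ode_of_eventuallyEq hr.ne' (eventuallyEq_of_mem (Ioi_mem_nhds h') fun x hx =>
        (if_neg (not_le.2 (hAB.trans hx))).trans (if_neg (not_le.2 hx)))
        (by push_cast; ring) (by push_cast; ring)

theorem stmt8 (N : ℕ) (hN : 10 ≤ N) (A B : ℝ)
    (hA : 0 < A) (hAB : A < B) (hB : B ≤ 1) :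
    (∀ r ∈ Set.Ioc (0:ℝ) 1, 0 < omegaAB N A B r) ∧
    ContDiffOn ℝ 1 (omegaAB N A B) (Set.Ioc 0 1) ∧
    omegaAB N A B 1 = 1 ∧
    IntervalIntegrable
      (fun r => r ^ (N - 1) * (omegaAB N A B r ^ 2 + deriv (omegaAB N A B) r ^ 2))
      volume 0 1 ∧
    ∀ r ∈ Set.Ioo (0:ℝ) 1, r ≠ A → r ≠ B →
      deriv (deriv (omegaAB N A B)) r + ((N:ℝ) - 1) / r * deriv (omegaAB N A B) r
        + (PsiAB N A B r - ((N:ℝ) - 1) / r ^ 2) * omegaAB N A B r = 0 := by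
  refine ⟨fun r hr => omegaAB_pos N (by omega) hA hAB hr.1,
    (contDiff_omegaAB N (by omega) hA hAB).contDiffOn,
    omegaAB_one N (by omega) hA hAB hB, ?_,
    fun r hr hrA hrB => omegaAB_ode N (by omega) hA hAB hr.1 hrA hrB⟩
  have h := contDiff_omegaAB N (by omega) hA hAB
  have h₀ := h.continuous
  have h₁ := h.continuous_deriv le_rfl
  exact Continuous.intervalIntegrable (by fun_prop) 0 1
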